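/- ∑_{k=1}^∞ ζ(2k)/((k+1)(2k+1)) = 1/2, and ∑_{k=1}^∞ ζ(2k)/(4^k (k+1)(2k+1)) = 1/2 − 7ζ(3)/(2π²). -/

import Mathlib

open Real Complex

noncomputable def Zr (k : ℕ) : ℝ := ∑' n : ℕ, 1 / ((n : ℝ) + 1) ^ (2 * k + 2)

lemma Zr_summable (k : ℕ) : Summable (fun n : ℕ => 1 / ((n : ℝ) + 1) ^ (2 * k + 2)) := by
  have := (summable_nat_add_iff 1).2 (Real.summable_one_div_nat_pow (p := 2 * k + 2) |>.2 (by omega))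
  simpa using this

lemma Zr_nonneg (k : ℕ) : 0 ≤ Zr k := tsum_nonneg fun n => by positivity

lemma Zr_le (k : ℕ) : Zr k ≤ Zr 0 := by
  refine (Zr_summable k).tsum_le_tsum (fun n => ?_) (Zr_summable 0)
  apply one_div_le_one_div_of_le (by positivity)
  exact pow_le_pow_right₀ (by linarith [(Nat.cast_nonneg n : (0:ℝ) ≤ n)]) (by omega)

lemma Zr_zeta (k : ℕ) : riemannZeta (2 * ((k : ℂ) + 1)) = (Zr k : ℂ) := by
  have h := zeta_nat_eq_tsum_of_gt_one (k := 2 * k + 2) (by omega)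
  have e : ((2 * k + 2 : ℕ) : ℂ) = 2 * ((k : ℂ) + 1) := by push_cast; ring
  rw [e] at h
  rw [h, Zr, Complex.ofReal_tsum]
  have hs : Summable (fun n : ℕ => 1 / (n : ℂ) ^ (2 * k + 2)) := by
    have := Real.summable_one_div_nat_pow (p := 2 * k + 2) |>.2 (by omega)
    have := Complex.ofRealCLM.summable this
    simpa using this
  rw [hs.tsum_eq_zero_add]
  simp

lemma cot_real (x : ℝ) (h0 : 0 < x) (h1 : x < 1) :
    HasSum (fun n : ℕ => x ^ 2 / (((n : ℝ) + 1) ^ 2 - x ^ 2)) ((1 - π * x * Real.cot (π * x)) / 2) := by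
  have hz : (x : ℂ) ∈ Complex.integerComplement := by
    rintro ⟨n, hn⟩
    have : (n : ℝ) = x := by exact_mod_cast hn
    rw [← this] at h0 h1
    norm_cast at h0 h1
    omega
  have h := (summable_cotTerm hz).hasSum
  have h2 := cot_series_rep' hz
  have h3 : HasSum (fun n : ℕ => (1 / ((x:ℂ) - (n + 1)) + 1 / (x + (n + 1)))) (π * Complex.cot (π * x) - 1 / x) := by
    rw [h2]; exact h
  have h4 := h3.mul_left (-(x : ℂ) / 2)
  rw [← Complex.hasSum_ofReal]
  convert! h4 using 1
  · ext n
    have hn : (0:ℝ) ≤ n := n.cast_nonneg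
    have a : x - ((n:ℝ) + 1) ≠ 0 := by linarith
    have b : x + ((n:ℝ) + 1) ≠ 0 := by linarith
    have c : ((n:ℝ) + 1) ^ 2 - x ^ 2 ≠ 0 := by
      rw [show ((n:ℝ) + 1) ^ 2 - x ^ 2 = -((x - ((n:ℝ) + 1)) * (x + ((n:ℝ) + 1))) by ring]
      exact neg_ne_zero.2 (mul_ne_zero a b)
    have key : x ^ 2 / (((n : ℝ) + 1) ^ 2 - x ^ 2) =
        -x / 2 * (1 / (x - ((n : ℝ) + 1)) + 1 / (x + ((n : ℝ) + 1))) := by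
      rw [div_add_div _ _ a b, div_mul_div_comm, div_eq_div_iff c (mul_ne_zero two_ne_zero (mul_ne_zero a b))]
      ring
    rw [key]
    push_cast
    rfl
  · have : (x : ℂ) ≠ 0 := by exact_mod_cast h0.ne'
    push_cast
    field_simp
    ring

lemma Zr_gen (x : ℝ) (h0 : 0 < x) (h1 : x < 1) :
    HasSum (fun k : ℕ => Zr k * x ^ (2 * k + 2)) ((1 - π * x * Real.cot (π * x)) / 2) := by
  have hc := cot_real x h0 h1
  have hg : ∀ n : ℕ, HasSum (fun k : ℕ => x ^ (2 * k + 2) / ((n : ℝ) + 1) ^ (2 * k + 2))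
      (x ^ 2 / (((n : ℝ) + 1) ^ 2 - x ^ 2)) := by
    intro n
    have hn : (0:ℝ) ≤ n := n.cast_nonneg
    have hr : (x / ((n : ℝ) + 1)) ^ 2 < 1 := by
      have : x / ((n : ℝ) + 1) < 1 := by rw [div_lt_one (by positivity)]; linarith
      exact pow_lt_one₀ (by positivity) this (by norm_num)
    have := (hasSum_geometric_of_lt_one (by positivity) hr).mul_left ((x / ((n : ℝ) + 1)) ^ 2)
    convert! this using 1
    · ext k; rw [← div_pow, ← pow_mul, ← pow_add]; congr 1; ring
    · have : ((n:ℝ) + 1) ^ 2 - x ^ 2 ≠ 0 := by nlinarith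
      have h3 : 1 - (x / ((n : ℝ) + 1)) ^ 2 ≠ 0 := by linarith
      have h4 : 1 - (x / ((n : ℝ) + 1)) ^ 2 = (((n:ℝ) + 1) ^ 2 - x ^ 2) / ((n : ℝ) + 1) ^ 2 := by
        field_simp
      rw [h4]
      field_simp
  let f : ℕ × ℕ → ℝ := fun p => x ^ (2 * p.2 + 2) / ((p.1 : ℝ) + 1) ^ (2 * p.2 + 2)
  have hs : Summable f := by
    rw [summable_prod_of_nonneg (fun p => by positivity)]
    refine ⟨fun n => (hg n).summable, ?_⟩
    refine hc.summable.congr fun n => ?_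
    exact (hg n).tsum_eq.symm
  have hk : ∀ k : ℕ, HasSum (fun n : ℕ => f (n, k)) (Zr k * x ^ (2 * k + 2)) := by
    intro k
    have := (Zr_summable k).hasSum.mul_right (x ^ (2 * k + 2))
    convert! this using 1
    ext n
    simp only [f]; ring
  have e1 : HasSum f ((1 - π * x * Real.cot (π * x)) / 2) := by
    have := hs.hasSum.prod_fiberwise hg
    rw [hc.unique this]; exact hs.hasSum
  have e2 := (Equiv.prodComm ℕ ℕ).hasSum_iff.2 e1
  exact e2.prod_fiberwise hk

lemma h_int (c : ℝ) (h0 : 0 < c) (h1 : c ≤ 1) :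
    IntervalIntegrable (fun u : ℝ => u * (1 - u) * Real.cot (π * (c * u))) MeasureTheory.volume 0 1 := by
  rw [intervalIntegrable_iff_integrableOn_Ioo_of_le zero_le_one]
  refine MeasureTheory.Measure.integrableOn_of_bounded (M := 1 / (2 * c)) (by simp) ?_ ?_
  · simp_rw [Real.cot_eq_cos_div_sin]
    exact Measurable.aestronglyMeasurable (by fun_prop)
  · refine (MeasureTheory.ae_restrict_iff' measurableSet_Ioo).2 (Filter.Eventually.of_forall ?_)
    rintro u ⟨hu0, hu1⟩
    have hp := Real.pi_pos
    have hs : 2 * c * (u * (1 - u)) ≤ Real.sin (π * (c * u)) := by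
      rcases le_total (c * u) (1 / 2) with h | h
      · have := Real.mul_le_sin (x := π * (c * u)) (by positivity) (by nlinarith)
        rw [show 2 / π * (π * (c * u)) = 2 * (c * u) by field_simp] at this
        nlinarith [mul_pos (mul_pos h0 hu0) hu0]
      · have hcu : c * u ≤ u := by nlinarith
        have := Real.mul_le_sin (x := π * (1 - c * u)) (by apply mul_nonneg hp.le; linarith) (by nlinarith)
        rw [show 2 / π * (π * (1 - c * u)) = 2 * (1 - c * u) by field_simp,
          show π * (1 - c * u) = π - π * (c * u) by ring, Real.sin_pi_sub] at this
        nlinarith [mul_pos h0 hu0]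
    have hpos : 0 < u * (1 - u) := mul_pos hu0 (by linarith)
    have hsp : 0 < Real.sin (π * (c * u)) := lt_of_lt_of_le (by positivity) hs
    rw [Real.cot_eq_cos_div_sin, Real.norm_eq_abs, abs_mul, abs_div, abs_of_pos hpos, abs_of_pos hsp,
      ← mul_div_assoc, div_le_div_iff₀ hsp (by positivity)]
    have := Real.abs_cos_le_one (π * (c * u))
    have : u * (1 - u) * |Real.cos (π * (c * u))| ≤ u * (1 - u) := mul_le_of_le_one_right hpos.le this
    nlinarith

lemma int_one : ∫ u in (0:ℝ)..1, u * (1 - u) * Real.cot (π * (1 * u)) = 0 := by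
  have h := intervalIntegral.integral_comp_sub_left (a := 0) (b := 1) 
    (fun u : ℝ => u * (1 - u) * Real.cot (π * (1 * u))) 1
  have e : ∀ u : ℝ, (1 - u) * (1 - (1 - u)) * Real.cot (π * (1 * (1 - u))) = 
     - (u * (1 - u) * Real.cot (π * (1 * u))) := by
    intro u
    rw [show π * (1 * (1 - u)) = π - π * (1 * u) by ring, Real.cot_eq_cos_div_sin, Real.cot_eq_cos_div_sin,
      Real.sin_pi_sub, Real.cos_pi_sub]
    ring
  simp_rw [e] at h
  rw [intervalIntegral.integral_neg] at h
  norm_num at h ⊢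
  linarith

lemma int_split (c : ℝ) (h0 : 0 < c) (h1 : c ≤ 1) :
    ∫ u in (0:ℝ)..1, (1 - u) * (1 - π * (c * u) * Real.cot (π * (c * u))) =
    1 / 2 - π * c * ∫ u in (0:ℝ)..1, u * (1 - u) * Real.cot (π * (c * u)) := by
  rw [← intervalIntegral.integral_const_mul]
  have : ∫ u in (0:ℝ)..1, (1 - u) = 1 / 2 := by
    rw [intervalIntegral.integral_sub (by simp) (by simp)]; simp; norm_num
  rw [← this, ← intervalIntegral.integral_sub (Continuous.intervalIntegrable (by fun_prop) _ _)
    ((h_int c h0 h1).const_mul _)]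
  congr 1
  ext u
  ring

noncomputable def Dk (n : ℕ) (t : ℝ) : ℝ :=
  ∑ j ∈ Finset.range n, (Real.cos (2 * ((j : ℝ) + 1) * t) + Real.cos (2 * j * t))

lemma Dk_eq (n : ℕ) (t : ℝ) (ht : Real.sin t ≠ 0) : Real.cot t * Real.sin (2 * n * t) = Dk n t := by
  induction n with
  | zero => simp [Dk]
  | succ n ih =>
    rw [Dk, Finset.sum_range_succ, ← Dk, ← ih, Real.cot_eq_cos_div_sin]
    push_cast
    rw [show 2 * ((n:ℝ) + 1) * t = 2 * n * t + 2 * t by ring, Real.sin_add, Real.cos_add, Real.sin_two_mul, Real.cos_two_mul]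
    have := Real.sin_sq_add_cos_sq t
    field_simp
    have h2 : Real.sin t ^ 2 = 1 - Real.cos t ^ 2 := by linarith
    linear_combination (2 * Real.cos t * Real.sin (2 * n * t)) * h2

lemma Dk_le (n : ℕ) (t : ℝ) : |Dk n t| ≤ 2 * n := by
  refine (Finset.abs_sum_le_sum_abs _ _).trans ?_
  calc _ ≤ ∑ j ∈ Finset.range n, (2:ℝ) := Finset.sum_le_sum fun j _ => by
        refine (abs_add_le _ _).trans ?_
        linarith [Real.abs_cos_le_one (2 * ((j : ℝ) + 1) * t), Real.abs_cos_le_one (2 * (j : ℝ) * t)]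
    _ = _ := by simp [mul_comm]

lemma int_cos (m : ℕ) : ∫ u in (0:ℝ)..1, Real.cos (2 * (m : ℝ) * (π * (1 / 2 * u))) = if m = 0 then 1 else 0 := by
  split_ifs with h
  · simp [h]
  · have : (m : ℝ) * π ≠ 0 := by have := Real.pi_ne_zero; positivity
    simp_rw [show ∀ u : ℝ, 2 * (m : ℝ) * (π * (1 / 2 * u)) = (m * π) * u by intro u; ring]
    rw [intervalIntegral.integral_comp_mul_left _ this]
    simp

lemma int_Dk (n : ℕ) (hn : n ≠ 0) : ∫ u in (0:ℝ)..1, Dk n (π * (1 / 2 * u)) = 1 := by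
  unfold Dk
  rw [intervalIntegral.integral_finsetSum (fun j _ => Continuous.intervalIntegrable (by fun_prop) _ _)]
  have : ∀ j ∈ Finset.range n, ∫ u in (0:ℝ)..1, (Real.cos (2 * ((j : ℝ) + 1) * (π * (1 / 2 * u))) + Real.cos (2 * j * (π * (1 / 2 * u)))) = if j = 0 then 1 else 0 := by
    intro j _
    rw [intervalIntegral.integral_add (Continuous.intervalIntegrable (by fun_prop) _ _) (Continuous.intervalIntegrable (by fun_prop) _ _), int_cos]
    have := int_cos (j + 1)
    push_cast at this
    rw [this]; simp
  rw [Finset.sum_congr rfl this]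
  simp; omega

noncomputable def ak (n : ℕ) : ℝ := (1 - (-1) ^ n) / (n : ℝ) ^ 3

lemma fourier_u (u : ℝ) (h0 : 0 ≤ u) (h1 : u ≤ 1) :
    HasSum (fun n : ℕ => ak n * Real.sin (2 * n * (π * (1 / 2 * u)))) (π ^ 3 / 4 * (u * (1 - u))) := by
  have a := hasSum_one_div_nat_pow_mul_sin (k := 1) one_ne_zero (x := u / 2) ⟨by linarith, by linarith⟩
  have b := hasSum_one_div_nat_pow_mul_sin (k := 1) one_ne_zero (x := (u + 1) / 2) ⟨by linarith, by linarith⟩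
  have hB : ∀ x : ℝ, (Polynomial.map (algebraMap ℚ ℝ) (Polynomial.bernoulli (2 * 1 + 1))).eval x = x ^ 3 - 3 / 2 * x ^ 2 + x / 2 := by
    intro x
    simp only [Polynomial.bernoulli, Finset.sum_range_succ, Finset.sum_range_zero]
    have b2 : bernoulli 2 = 1 / 6 := by rw [bernoulli_eq_bernoulli'_of_ne_one (by norm_num), bernoulli'_two]
    have b3 : bernoulli 3 = 0 := by rw [bernoulli_eq_bernoulli'_of_ne_one (by norm_num), bernoulli'_three]
    simp [Nat.choose, b2, b3, bernoulli_one, Polynomial.eval_monomial]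
    ring
  rw [hB] at a b
  convert! a.sub b using 1
  · ext n
    rw [show 2 * π * (n : ℝ) * ((u + 1) / 2) = π * n * u + n * π by ring, Real.sin_add_nat_mul_pi, ak,
      show 2 * (n : ℝ) * (π * (1 / 2 * u)) = π * n * u by ring, show 2 * π * (n : ℝ) * (u / 2) = π * n * u by ring]
    ring
  · simp [Nat.factorial]; ring

lemma ak_sum (z : ℝ) (hz : HasSum (fun n : ℕ => 1 / (n : ℝ) ^ 3) z) : HasSum ak (7 / 4 * z) := by
  have he : HasSum (fun k : ℕ => 1 / ((2 * k : ℕ) : ℝ) ^ 3) (z / 8) := by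
    convert! hz.div_const 8 using 1
    ext k
    push_cast
    rw [div_div]; congr 1; ring
  have ho : Summable (fun k : ℕ => 1 / ((2 * k + 1 : ℕ) : ℝ) ^ 3) :=
    hz.summable.comp_injective (i := fun k : ℕ => 2 * k + 1) (fun a b h => by simpa using h)
  have ho2 := ho.hasSum
  have := (HasSum.even_add_odd (f := fun n : ℕ => 1 / (n : ℝ) ^ 3) he ho2).unique hz
  have h1 : HasSum (fun k : ℕ => ak (2 * k)) 0 := by
    convert! hasSum_zero (α := ℝ) (β := ℕ) with k
    simp [ak]
  have h2 : HasSum (fun k : ℕ => ak (2 * k + 1)) (2 * (7 / 8 * z)) := by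
    rw [show 7 / 8 * z = ∑' (k : ℕ), 1 / ((2 * k + 1 : ℕ) : ℝ) ^ 3 by linarith]
    convert! ho2.mul_left 2 using 1
    ext k
    have : (-1 : ℝ) ^ (2 * k + 1) = -1 := by simp [pow_succ]
    rw [ak, this]
    ring
  have := h1.even_add_odd h2
  convert! this using 1; ring

lemma ak_abs (n : ℕ) : |ak n| * (2 * n) ≤ 4 * (1 / (n : ℝ) ^ 2) := by
  rcases Nat.eq_zero_or_pos n with h | h
  · simp [h]
  have hn : (0:ℝ) < n := by exact_mod_cast h
  rw [ak, abs_div, abs_of_pos (pow_pos hn 3)]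
  have : |1 - (-1 : ℝ) ^ n| ≤ 2 := by
    refine (abs_sub _ _).trans ?_
    simp; norm_num
  calc _ ≤ 2 / (n:ℝ) ^ 3 * (2 * n) := by gcongr
    _ = _ := by field_simp; norm_num

lemma int_half (z : ℝ) (hz : HasSum (fun n : ℕ => 1 / (n : ℝ) ^ 3) z) :
    π ^ 3 / 4 * ∫ u in (0:ℝ)..1, u * (1 - u) * Real.cot (π * (1 / 2 * u)) = 7 / 4 * z := by
  rw [← intervalIntegral.integral_const_mul]
  have H := intervalIntegral.hasSum_integral_of_dominated_convergence (a := 0) (b := 1) (μ := MeasureTheory.volume)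
    (F := fun (n : ℕ) (u : ℝ) => ak n * Dk n (π * (1 / 2 * u)))
    (f := fun u => π ^ 3 / 4 * (u * (1 - u) * Real.cot (π * (1 / 2 * u))))
    (fun n _ => 4 * (1 / (n : ℝ) ^ 2))
    (fun n => Continuous.aestronglyMeasurable (by unfold Dk; fun_prop))
    (fun n => Filter.Eventually.of_forall fun u _ => by
      rw [Real.norm_eq_abs, abs_mul]
      exact (mul_le_mul_of_nonneg_left (Dk_le n _) (abs_nonneg _)).trans (ak_abs n))
    (Filter.Eventually.of_forall fun u _ => (Real.summable_one_div_nat_pow.2 (by norm_num)).mul_left 4)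
    (by simp)
    (Filter.Eventually.of_forall fun u hu => by
      rw [Set.uIoc_of_le zero_le_one] at hu
      have hs : Real.sin (π * (1 / 2 * u)) ≠ 0 := by
        apply ne_of_gt
        have hp := Real.pi_pos
        apply Real.sin_pos_of_pos_of_lt_pi
        · have := hu.1; positivity
        · nlinarith [hu.2]
      convert! (fourier_u u hu.1.le hu.2).mul_right (Real.cot (π * (1 / 2 * u))) using 1
      · ext n
        rw [← Dk_eq n _ hs]; ring
      · ring)
  refine H.unique ?_
  convert! ak_sum z hz using 1
  ext n
  rw [intervalIntegral.integral_const_mul]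
  rcases eq_or_ne n 0 with h | h
  · simp [h, ak]
  · rw [int_Dk n h, mul_one]

lemma int_poly (c : ℝ) (k : ℕ) :
    ∫ u in (0:ℝ)..1, 2 * (1 - u) * (Zr k * (c * u) ^ (2 * k + 2)) =
      Zr k * c ^ (2 * k + 2) / (((k : ℝ) + 2) * (2 * k + 3)) := by
  have e : ∀ u : ℝ, 2 * (1 - u) * (Zr k * (c * u) ^ (2 * k + 2)) =
      2 * Zr k * c ^ (2 * k + 2) * (u ^ (2 * k + 2) - u ^ (2 * k + 3)) := by
    intro u; ring
  simp_rw [e]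
  rw [intervalIntegral.integral_const_mul, intervalIntegral.integral_sub (by simp) (by simp),
    integral_pow, integral_pow]
  have h1 : (2 * (k:ℝ) + 2 + 1) ≠ 0 := by positivity
  have h2 : (2 * (k:ℝ) + 3 + 1) ≠ 0 := by positivity
  have h3 : (2 * (k:ℝ) + 3) ≠ 0 := by positivity
  have h4 : ((k:ℝ) + 2) ≠ 0 := by positivity
  push_cast
  simp only [one_pow]
  rw [zero_pow (by omega), zero_pow (by omega)]
  field_simp
  ring

lemma main_sum (c : ℝ) (h0 : 0 < c) (h1 : c ≤ 1) :
    HasSum (fun k : ℕ => Zr k * c ^ (2 * k + 2) / (((k : ℝ) + 2) * (2 * k + 3)))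
      (∫ u in (0:ℝ)..1, (1 - u) * (1 - π * (c * u) * Real.cot (π * (c * u)))) := by
  have conv : ∀ f : ℝ → ℝ, ∫ u in (0:ℝ)..1, f u = ∫ u in Set.Ioo (0:ℝ) 1, f u := by
    intro f
    rw [intervalIntegral.integral_of_le zero_le_one, MeasureTheory.integral_Ioc_eq_integral_Ioo]
  have hn : ∀ k : ℕ, ∫ u in Set.Ioo (0:ℝ) 1, ‖2 * (1 - u) * (Zr k * (c * u) ^ (2 * k + 2))‖ =
      Zr k * c ^ (2 * k + 2) / (((k : ℝ) + 2) * (2 * k + 3)) := by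
    intro k
    rw [← int_poly, conv]
    refine MeasureTheory.setIntegral_congr_fun measurableSet_Ioo fun u hu => ?_
    have := Zr_nonneg k
    have h2 : 0 < 1 - u := by linarith [hu.2]
    have h3 := hu.1
    exact Real.norm_of_nonneg (by positivity)
  have H := MeasureTheory.hasSum_integral_of_summable_integral_norm
    (μ := MeasureTheory.volume.restrict (Set.Ioo (0:ℝ) 1))
    (F := fun (k : ℕ) (u : ℝ) => 2 * (1 - u) * (Zr k * (c * u) ^ (2 * k + 2)))
    (fun k => ((Continuous.integrableOn_Icc (by fun_prop)).mono_set Set.Ioo_subset_Icc_self)) (by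
      simp_rw [hn]
      have hs : Summable (fun n : ℕ => Zr 0 * (1 / ((n : ℝ) + 1) ^ 2)) := by
        have := (summable_nat_add_iff 1).2 (Real.summable_one_div_nat_pow (p := 2) |>.2 (by omega))
        exact Summable.mul_left _ (by simpa using this)
      refine hs.of_nonneg_of_le (fun k => ?_) (fun k => ?_)
      · have := Zr_nonneg k; positivity
      · rw [mul_one_div]
        have hz := Zr_nonneg k
        have hz0 := Zr_nonneg 0
        apply div_le_div₀ hz0 _ (by positivity) (by nlinarith [(Nat.cast_nonneg k : (0:ℝ) ≤ k)])
        exact (mul_le_of_le_one_right hz (pow_le_one₀ h0.le h1)).trans (Zr_le k))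
  rw [conv]
  convert! H using 1
  · ext k; rw [← int_poly, conv]
  · refine MeasureTheory.setIntegral_congr_fun measurableSet_Ioo fun u hu => ?_
    have h3 := hu.1
    have := (Zr_gen (c * u) (by positivity) (by nlinarith [hu.2])).mul_left (2 * (1 - u))
    rw [this.tsum_eq]
    ring

theorem stmt19 :
    (∑' k : ℕ, riemannZeta (2 * ((k : ℂ) + 1))
        / ((((k : ℂ) + 1) + 1) * (2 * ((k : ℂ) + 1) + 1)) = 1 / 2) ∧
    (∑' k : ℕ, riemannZeta (2 * ((k : ℂ) + 1))
        / ((4 : ℂ) ^ (k + 1) * (((k : ℂ) + 1) + 1) * (2 * ((k : ℂ) + 1) + 1))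
      = 1 / 2 - 7 * riemannZeta 3 / (2 * (π : ℂ) ^ 2)) := by
  constructor
  · have h := main_sum 1 one_pos le_rfl
    rw [int_split 1 one_pos le_rfl, int_one] at h
    have h2 := Complex.hasSum_ofReal.2 h
    refine HasSum.tsum_eq ?_
    convert! h2 using 1
    · ext k
      rw [Zr_zeta]
      push_cast
      congr 1
      · ring
      · ring
    · push_cast; ring
  · have hs : Summable (fun n : ℕ => 1 / (n : ℝ) ^ 3) := Real.summable_one_div_nat_pow.2 (by norm_num)
    have hz := hs.hasSum
    have hz3 : riemannZeta 3 = ((∑' n : ℕ, 1 / (n : ℝ) ^ 3 : ℝ) : ℂ) := by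
      have := zeta_nat_eq_tsum_of_gt_one (k := 3) (by norm_num)
      push_cast at this ⊢
      exact this
    rw [hz3]
    generalize (∑' n : ℕ, 1 / (n : ℝ) ^ 3) = z at hz
    have h := main_sum (1 / 2) (by norm_num) (by norm_num)
    have hi := int_half z hz
    have hp := Real.pi_pos
    have hv : 1 / 2 - π * (1 / 2) * ∫ u in (0:ℝ)..1, u * (1 - u) * Real.cot (π * (1 / 2 * u)) =
        1 / 2 - 7 * z / (2 * π ^ 2) := by
      generalize (∫ u in (0:ℝ)..1, u * (1 - u) * Real.cot (π * (1 / 2 * u))) = J at hi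
      have : z = π ^ 3 * J / 7 := by linarith
      rw [this]; field_simp
    rw [int_split (1 / 2) (by norm_num) (by norm_num), hv] at h
    have h2 := Complex.hasSum_ofReal.2 h
    refine HasSum.tsum_eq ?_
    convert! h2 using 1
    · ext k
      rw [Zr_zeta]
      push_cast
      rw [show 2 * k + 2 = 2 * (k + 1) by ring, pow_mul, show ((1:ℂ) / 2) ^ 2 = 1 / 4 by norm_num, one_div_pow,
        mul_one_div, div_div]
      congr 1
      ring
    · push_cast; ring
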